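/- arXiv:1103.1672 — 4 statements merged into one kernel-verified Lean document; each statement's English description precedes it below -/
import Mathlib

section
/- Symmetric GDoF for M > N: let M > N ≥ 1 be integers and α ≥ 0 a real. For the (M,N,M,N) interference channel with exponents (1,α,α,1), the symmetric GDoF satisfies d_sym((M,N,M,N),(1,α,α,1)) = min{ N, D(α) }, where D(α) = N−(2N−M)α for 0 ≤ α < 1/2; D(α) = (M−N)+(2N−M)α for 1/2 ≤ α ≤ 2/3; D(α) = N−(α/2)(2N−M) for 2/3 ≤ α ≤ 1; and D(α) = M/2 + (N/2)(α−1) for α ≥ 1. -/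
/-- The two-pair function `f(u,(a₁,u₁),(a₂,u₂))`. -/
noncomputable def fFun (u : ℝ) (p q : ℝ × ℝ) : ℝ :=
  if q.1 ≤ p.1 then min u p.2 * p.1 + min (max (u - p.2) 0) q.2 * q.1
  else min u q.2 * q.1 + min (max (u - q.2) 0) p.2 * p.1

/-- The three-pair expression evaluated in the given order. -/
noncomputable def gAux (u : ℝ) (p q r : ℝ × ℝ) : ℝ :=
  min u p.2 * p.1 + min (max (u - p.2) 0) q.2 * q.1
    + min (max (u - p.2 - q.2) 0) r.2 * r.1

/-- The three-pair function `g`, defined by sorting the pairs in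
nonincreasing order of their first components. -/
noncomputable def gFun (u : ℝ) (p q r : ℝ × ℝ) : ℝ :=
  if q.1 ≤ p.1 then
    if r.1 ≤ q.1 then gAux u p q r
    else if r.1 ≤ p.1 then gAux u p r q
    else gAux u r p q
  else
    if r.1 ≤ p.1 then gAux u q p r
    else if r.1 ≤ q.1 then gAux u q r p
    else gAux u r q p

/-- The GDoF region `D_o((M₁,N₁,M₂,N₂),(1,α₁₂,α₂₁,α₂₂))` of the 2-user MIMO
interference channel (Theorem 1). -/
noncomputable def GDoF (M1 N1 M2 N2 : ℕ) (a12 a21 a22 : ℝ) : Set (ℝ × ℝ) :=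
  { d : ℝ × ℝ |
    0 ≤ d.1 ∧ 0 ≤ d.2 ∧
    d.1 ≤ min (M1 : ℝ) (N1 : ℝ) ∧
    d.2 ≤ min (M2 : ℝ) (N2 : ℝ) ∧
    d.1 + a22 * d.2 ≤
      fFun (N2 : ℝ) (a12, (M1 : ℝ)) (a22, (M2 : ℝ)) +
      fFun (N1 : ℝ) (max (1 - a12) 0, min (M1 : ℝ) (N2 : ℝ)) (1, max ((M1 : ℝ) - (N2 : ℝ)) 0) ∧
    d.1 + a22 * d.2 ≤
      fFun (N1 : ℝ) (a21, (M2 : ℝ)) (1, (M1 : ℝ)) +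
      fFun (N2 : ℝ) (max (a22 - a21) 0, min (M2 : ℝ) (N1 : ℝ)) (a22, max ((M2 : ℝ) - (N1 : ℝ)) 0) ∧
    d.1 + a22 * d.2 ≤
      gFun (N1 : ℝ) (a21, (M2 : ℝ)) (max (1 - a12) 0, min (M1 : ℝ) (N2 : ℝ))
        (1, max ((M1 : ℝ) - (N2 : ℝ)) 0) +
      gFun (N2 : ℝ) (a12, (M1 : ℝ)) (max (a22 - a21) 0, min (M2 : ℝ) (N1 : ℝ))
        (a22, max ((M2 : ℝ) - (N1 : ℝ)) 0) ∧
    2 * d.1 + a22 * d.2 ≤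
      fFun (N1 : ℝ) (a21, (M2 : ℝ)) (1, (M1 : ℝ)) +
      fFun (N1 : ℝ) (max (1 - a12) 0, min (M1 : ℝ) (N2 : ℝ)) (1, max ((M1 : ℝ) - (N2 : ℝ)) 0) +
      gFun (N2 : ℝ) (a12, (M1 : ℝ)) (max (a22 - a21) 0, min (M2 : ℝ) (N1 : ℝ))
        (a22, max ((M2 : ℝ) - (N1 : ℝ)) 0) ∧
    d.1 + 2 * a22 * d.2 ≤
      fFun (M2 : ℝ) (a21, (N1 : ℝ)) (a22, (N2 : ℝ)) +
      fFun (N2 : ℝ) (max (a22 - a21) 0, min (M2 : ℝ) (N1 : ℝ)) (a22, max ((M2 : ℝ) - (N1 : ℝ)) 0) +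
      gFun (N1 : ℝ) (a21, (M2 : ℝ)) (max (1 - a12) 0, min (M1 : ℝ) (N2 : ℝ))
        (1, max ((M1 : ℝ) - (N2 : ℝ)) 0) }

/-- The symmetric GDoF `d_sym = sup { d ≥ 0 : (d,d) ∈ D_o }`. -/
noncomputable def dsym (M1 N1 M2 N2 : ℕ) (a12 a21 a22 : ℝ) : ℝ :=
  sSup { d : ℝ | 0 ≤ d ∧ (d, d) ∈ GDoF M1 N1 M2 N2 a12 a21 a22 }

theorem fFun_full (n m a b : ℝ) (hn : 0 ≤ n) (hnm : n ≤ m) :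
    fFun n (a, m) (b, m) = n * max b a := by
  have hm : 0 ≤ m := hn.trans hnm
  simp only [fFun, min_eq_left hnm, max_eq_right (sub_nonpos.2 hnm), min_eq_left hm]
  split_ifs with h
  · rw [max_eq_right h]; ring
  · rw [max_eq_left (not_le.1 h).le]; ring

theorem fFun_unit_second (n e b : ℝ) (hn : 0 ≤ n) (he : 0 ≤ e) (hb : b ≤ 1) :
    fFun n (b, n) (1, e) = min n e + (n - min n e) * b := by
  simp only [fFun, sub_self, max_self, min_self, min_eq_left he]
  split_ifs with h
  · obtain rfl : b = 1 := le_antisymm hb h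
    ring
  · rcases le_total n e with hne | hne
    · rw [min_eq_left hne, max_eq_right (sub_nonpos.2 hne), min_eq_left hn]; ring
    · rw [min_eq_right hne, max_eq_left (sub_nonneg.2 hne), min_eq_left (by linarith)]; ring

theorem le_fFun_of_le (n m a : ℝ) (hn : 0 ≤ n) (hnm : n ≤ m) (ha : 0 ≤ a) :
    n * max 1 a ≤ fFun m (a, n) (1, n) := by
  have h0 : 0 ≤ min (max (m - n) 0) n := le_min (le_max_right _ _) hn
  simp only [fFun, min_eq_right hnm]
  split_ifs with h
  · rw [max_eq_right h]; linarith
  · rw [max_eq_left (not_le.1 h).le]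
    have := mul_nonneg h0 ha
    linarith

theorem gAux_of_le_first (n p₁ p₂ q₁ q₂ r₁ r₂ : ℝ) (h : n ≤ p₂) (hq : 0 ≤ q₂) (hr : 0 ≤ r₂) :
    gAux n (p₁, p₂) (q₁, q₂) (r₁, r₂) = n * p₁ := by
  simp only [gAux, min_eq_left h, max_eq_right (sub_nonpos.2 h),
    max_eq_right (show n - p₂ - q₂ ≤ 0 by linarith), min_eq_left hq, min_eq_left hr]
  ring

theorem gAux_of_le_second (n p₁ p₂ q₁ q₂ r₁ r₂ : ℝ) (hn : 0 ≤ n) (hp : 0 ≤ p₂) (hq : n ≤ q₂)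
    (hr : 0 ≤ r₂) :
    gAux n (p₁, p₂) (q₁, q₂) (r₁, r₂) = min n p₂ * p₁ + (n - min n p₂) * q₁ := by
  simp only [gAux, max_eq_right (show n - p₂ - q₂ ≤ 0 by linarith), min_eq_left hr]
  rcases le_total n p₂ with h | h
  · rw [min_eq_left h, max_eq_right (sub_nonpos.2 h), min_eq_left (by linarith)]; ring
  · rw [min_eq_right h, max_eq_left (sub_nonneg.2 h), min_eq_left (by linarith)]; ring

theorem gFun_of_le_one (n m e a b : ℝ) (hn : 0 ≤ n) (hnm : n ≤ m) (he : 0 ≤ e)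
    (ha : a ≤ 1) (hb : b ≤ 1) :
    gFun n (a, m) (b, n) (1, e) = min n e + (n - min n e) * max a b := by
  have hm : 0 ≤ m := hn.trans hnm
  have hp := gAux_of_le_first n a m b n 1 e hnm hn he
  have hp' := gAux_of_le_first n a m 1 e b n hnm he hn
  have hq := gAux_of_le_first n b n a m 1 e le_rfl hm he
  have hq' := gAux_of_le_first n b n 1 e a m le_rfl he hm
  have hr := gAux_of_le_second n 1 e a m b n hn he hnm hn
  have hr' := gAux_of_le_second n 1 e b n a m hn he le_rfl hm
  simp only [gFun, hp, hp', hq, hq', hr, hr']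
  split_ifs with h₁ h₂ h₃ h₂ h₃
  · obtain rfl : a = 1 := by linarith
    rw [max_eq_left h₁]; ring
  · obtain rfl : a = 1 := by linarith
    rw [max_eq_left h₁]; ring
  · rw [max_eq_left h₁]; ring
  · linarith
  · obtain rfl : b = 1 := by linarith
    rw [max_eq_right ha]; ring
  · rw [max_eq_right (not_le.1 h₁).le]; ring

theorem gFun_of_one_le (n m e a b : ℝ) (hn : 0 ≤ n) (hnm : n ≤ m) (he : 0 ≤ e)
    (ha : 1 ≤ a) (hb : b ≤ 1) :
    gFun n (a, m) (b, n) (1, e) = n * a := by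
  simp only [gFun, if_pos (hb.trans ha), if_pos ha,
    gAux_of_le_first n a m b n 1 e hnm hn he, gAux_of_le_first n a m 1 e b n hnm he hn, ite_self]

/-- For `N ≤ M`, the symmetric GDoF of the `(M,N,M,N)` channel is governed by the single-user bound
and two of the sum-rate bounds; the weighted sum-rate bounds are redundant. -/
theorem dsym_eq_min (M N : ℕ) (hMN : N ≤ M) (α G : ℝ) (hα : 0 ≤ α)
    (hG : gFun (N : ℝ) (α, (M : ℝ)) (max (1 - α) 0, (N : ℝ)) (1, (M : ℝ) - N) = G) (hG₀ : 0 ≤ G) :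
    dsym M N M N α α 1 =
      min (N : ℝ) (min ((N * max 1 α + (min (N : ℝ) (M - N) +
        (N - min (N : ℝ) (M - N)) * max (1 - α) 0)) / 2) G) := by
  have hn : (0 : ℝ) ≤ N := N.cast_nonneg
  have hnm : (N : ℝ) ≤ M := by exact_mod_cast hMN
  have he : (0 : ℝ) ≤ M - N := sub_nonneg.2 hnm
  have hβ : max (1 - α) 0 ≤ 1 := max_le (by linarith) zero_le_one
  have hF := le_fFun_of_le N M α hn hnm hα
  have hP : 0 ≤ min (N : ℝ) (M - N) + (N - min (N : ℝ) (M - N)) * max (1 - α) 0 :=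
    add_nonneg (le_min hn he)
      (mul_nonneg (sub_nonneg.2 (min_le_left _ _)) (le_max_right _ _))
  have hC : 0 ≤ (N : ℝ) * max 1 α := mul_nonneg hn (zero_le_one.trans (le_max_left _ _))
  have hset : { d : ℝ | 0 ≤ d ∧ (d, d) ∈ GDoF M N M N α α 1 } =
      Set.Icc 0 (min (N : ℝ) (min ((N * max 1 α + (min (N : ℝ) (M - N) +
        (N - min (N : ℝ) (M - N)) * max (1 - α) 0)) / 2) G)) := by
    ext d
    simp only [GDoF, Set.mem_ofPred_eq, Set.mem_Icc, min_eq_right hnm, max_eq_left he,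
      fFun_full _ _ _ _ hn hnm, fFun_unit_second _ _ _ hn he hβ, hG, le_min_iff]
    constructor
    · rintro ⟨h₀, -, -, hN, -, hs, -, hg, -⟩
      exact ⟨h₀, hN, by linarith, by linarith⟩
    · rintro ⟨h₀, hN, hs, hg⟩
      refine ⟨h₀, h₀, h₀, hN, hN, ?_, ?_, ?_, ?_, ?_⟩ <;> linarith
  rw [dsym, hset, csSup_Icc]
  exact le_min hn (le_min (by linarith) hG₀)

theorem dsym_eq_min_of_le_one (M N : ℕ) (hMN : N ≤ M) (α : ℝ) (hα : 0 ≤ α) (hα₁ : α ≤ 1) :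
    dsym M N M N α α 1 =
      min (N : ℝ) (min (N - α / 2 * (N - min (N : ℝ) (M - N)))
        (min (N : ℝ) (M - N) + (N - min (N : ℝ) (M - N)) * max α (1 - α))) := by
  have hn : (0 : ℝ) ≤ N := N.cast_nonneg
  have hnm : (N : ℝ) ≤ M := by exact_mod_cast hMN
  have he : (0 : ℝ) ≤ M - N := sub_nonneg.2 hnm
  have hβ : max (1 - α) 0 = 1 - α := max_eq_left (by linarith)
  rw [dsym_eq_min M N hMN α _ hα (gFun_of_le_one N M (M - N) α _ hn hnm he hα₁
    (by rw [hβ]; linarith)), hβ, max_eq_left hα₁]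
  · congr 2
    ring
  · exact add_nonneg (le_min hn he)
      (mul_nonneg (sub_nonneg.2 (min_le_left _ _)) (hα.trans (le_max_left _ _)))

theorem dsym_eq_min_of_one_le (M N : ℕ) (hMN : N ≤ M) (α : ℝ) (hα : 1 ≤ α) :
    dsym M N M N α α 1 =
      min (N : ℝ) (min ((N * α + min (N : ℝ) (M - N)) / 2) (N * α)) := by
  have hn : (0 : ℝ) ≤ N := N.cast_nonneg
  have hnm : (N : ℝ) ≤ M := by exact_mod_cast hMN
  have hβ : max (1 - α) 0 = 0 := max_eq_right (by linarith)
  rw [dsym_eq_min M N hMN α _ (by linarith) (gFun_of_one_le N M (M - N) α _ hn hnm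
    (sub_nonneg.2 hnm) hα (by rw [hβ]; exact zero_le_one)) (mul_nonneg hn (by linarith)), hβ,
    max_eq_right hα, mul_zero, add_zero]

/-- symmetric GDoF of the `(M,N,M,N)` channel for `M > N`. -/
theorem dsym_MgtN (M N : ℕ) (hN : 1 ≤ N) (hMN : N < M) (α : ℝ) (hα : 0 ≤ α) :
    (α < 1 / 2 →
      dsym M N M N α α 1 = min (N : ℝ) ((N : ℝ) - (2 * (N : ℝ) - (M : ℝ)) * α)) ∧
    (1 / 2 ≤ α → α ≤ 2 / 3 →
      dsym M N M N α α 1 =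
        min (N : ℝ) (((M : ℝ) - (N : ℝ)) + (2 * (N : ℝ) - (M : ℝ)) * α)) ∧
    (2 / 3 ≤ α → α ≤ 1 →
      dsym M N M N α α 1 = min (N : ℝ) ((N : ℝ) - α / 2 * (2 * (N : ℝ) - (M : ℝ)))) ∧
    (1 ≤ α →
      dsym M N M N α α 1 = min (N : ℝ) ((M : ℝ) / 2 + (N : ℝ) / 2 * (α - 1))) := by
  have hn : (0 : ℝ) ≤ N := N.cast_nonneg
  have hnm : (N : ℝ) ≤ M := by exact_mod_cast hMN.le
  refine ⟨fun h => ?_, fun h h' => ?_, fun h h' => ?_, fun h => ?_⟩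
  · rw [dsym_eq_min_of_le_one M N hMN.le α hα (by linarith),
      max_eq_right (show α ≤ 1 - α by linarith)]
    rcases le_total (N : ℝ) (M - N) with hc | hc
    · rw [min_eq_left hc, min_eq_left (a := (N : ℝ)) (le_min (by linarith) (by linarith)),
        min_eq_left (a := (N : ℝ)) (by nlinarith)]
    · rw [min_eq_right hc, min_eq_right (b := (M : ℝ) - N + _) (by nlinarith)]
      congr 1
      ring
  · rw [dsym_eq_min_of_le_one M N hMN.le α hα (by linarith),
      max_eq_left (show 1 - α ≤ α by linarith)]
    rcases le_total (N : ℝ) (M - N) with hc | hc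
    · rw [min_eq_left hc, min_eq_left (a := (N : ℝ)) (le_min (by linarith) (by linarith)),
        min_eq_left (a := (N : ℝ)) (by nlinarith)]
    · rw [min_eq_right hc, min_eq_right (b := (M : ℝ) - N + _) (by nlinarith)]
      congr 1
      ring
  · rw [dsym_eq_min_of_le_one M N hMN.le α hα (by linarith),
      max_eq_left (show 1 - α ≤ α by linarith)]
    rcases le_total (N : ℝ) (M - N) with hc | hc
    · rw [min_eq_left hc, min_eq_left (a := (N : ℝ)) (le_min (by linarith) (by linarith)),
        min_eq_left (a := (N : ℝ)) (by nlinarith)]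
    · rw [min_eq_right hc, min_eq_left (b := (M : ℝ) - N + _) (by nlinarith)]
      congr 1
      ring
  · rw [dsym_eq_min_of_one_le M N hMN.le α h]
    have hNα : (N : ℝ) ≤ N * α := le_mul_of_one_le_right hn h
    rcases le_total (N : ℝ) (M - N) with hc | hc
    · rw [min_eq_left hc, min_eq_left (a := (N : ℝ)) (le_min (by linarith) hNα),
        min_eq_left (a := (N : ℝ)) (by linarith)]
    · rw [min_eq_right hc, min_eq_left (b := (N : ℝ) * α) (by linarith)]
      congr 1
      ring
end

section
/- Recovery of the SISO "W" curve: for all real α ≥ 0, the symmetric GDoF of the single-antenna interference channel satisfies d_sym((1,1,1,1),(1,α,α,1)) = 1−α for 0 ≤ α ≤ 1/2; = α for 1/2 ≤ α ≤ 2/3; = 1−α/2 for 2/3 ≤ α ≤ 1; = α/2 for 1 ≤ α ≤ 2; and = 1 for α ≥ 2. -/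
theorem fFun_one_one (a b : ℝ) : fFun 1 (a, 1) (b, 1) = max a b := by
  unfold fFun
  split_ifs with h
  · simpa using h
  · simpa using (not_le.mp h).le

theorem fFun_one_zero (b : ℝ) : fFun 1 (b, 1) (1, 0) = b := by
  unfold fFun
  split_ifs <;> simp

theorem gFun_one_one_zero (a b : ℝ) : gFun 1 (a, 1) (b, 1) (1, 0) = max a b := by
  rcases le_total b a with h | h
  · rw [max_eq_left h]
    unfold gFun
    split_ifs <;> simp [gAux]
  · rw [max_eq_right h]
    unfold gFun
    split_ifs <;> simp [gAux] <;> linarith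

/-- The diagonal of the symmetric single-antenna region. -/
theorem mem_GDoF_SISO_diag_iff (α d : ℝ) :
    0 ≤ d ∧ (d, d) ∈ GDoF 1 1 1 1 α α 1 ↔
      0 ≤ d ∧ d ≤ 1 ∧ 2 * d ≤ max α 1 + max (1 - α) 0 ∧ d ≤ max α (max (1 - α) 0) ∧
        3 * d ≤ max α 1 + max (1 - α) 0 + max α (max (1 - α) 0) := by
  simp only [GDoF, Set.mem_ofPred_eq, Nat.cast_one, sub_self, max_self, min_self,
    fFun_one_one, fFun_one_zero, gFun_one_one_zero]
  constructor
  · rintro ⟨h, -, -, h₁, -, h₂, -, h₃, h₄, -⟩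
    refine ⟨h, h₁, ?_, ?_, ?_⟩ <;> linarith
  · rintro ⟨h, h₁, h₂, h₃, h₄⟩
    refine ⟨h, h, h, h₁, h₁, ?_, ?_, ?_, ?_, ?_⟩ <;> linarith

theorem dsym_SISO_eq_of_isGreatest {α c : ℝ}
    (h : IsGreatest { d : ℝ | 0 ≤ d ∧ d ≤ 1 ∧ 2 * d ≤ max α 1 + max (1 - α) 0 ∧
      d ≤ max α (max (1 - α) 0) ∧
      3 * d ≤ max α 1 + max (1 - α) 0 + max α (max (1 - α) 0) } c) :
    dsym 1 1 1 1 α α 1 = c := by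
  simp only [dsym, mem_GDoF_SISO_diag_iff]
  exact h.csSup_eq

/-- recovery of the SISO "W" curve. -/
theorem dsym_SISO_W (α : ℝ) (hα : 0 ≤ α) :
    (α ≤ 1 / 2 → dsym 1 1 1 1 α α 1 = 1 - α) ∧
    (1 / 2 ≤ α → α ≤ 2 / 3 → dsym 1 1 1 1 α α 1 = α) ∧
    (2 / 3 ≤ α → α ≤ 1 → dsym 1 1 1 1 α α 1 = 1 - α / 2) ∧
    (1 ≤ α → α ≤ 2 → dsym 1 1 1 1 α α 1 = α / 2) ∧
    (2 ≤ α → dsym 1 1 1 1 α α 1 = 1) := by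
  refine ⟨?_, ?_, ?_, ?_, ?_⟩
  · intro h
    apply dsym_SISO_eq_of_isGreatest
    rw [max_eq_right (by linarith : α ≤ 1), max_eq_left (by linarith : 0 ≤ 1 - α),
      max_eq_right (by linarith : α ≤ 1 - α)]
    refine ⟨⟨?_, ?_, ?_, ?_, ?_⟩, fun d ⟨_, _, _, _, _⟩ => ?_⟩ <;> linarith
  · intro h₁ h₂
    apply dsym_SISO_eq_of_isGreatest
    rw [max_eq_right (by linarith : α ≤ 1), max_eq_left (by linarith : 0 ≤ 1 - α),
      max_eq_left (by linarith : 1 - α ≤ α)]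
    refine ⟨⟨?_, ?_, ?_, ?_, ?_⟩, fun d ⟨_, _, _, _, _⟩ => ?_⟩ <;> linarith
  · intro h₁ h₂
    apply dsym_SISO_eq_of_isGreatest
    rw [max_eq_right (by linarith : α ≤ 1), max_eq_left (by linarith : 0 ≤ 1 - α),
      max_eq_left (by linarith : 1 - α ≤ α)]
    refine ⟨⟨?_, ?_, ?_, ?_, ?_⟩, fun d ⟨_, _, _, _, _⟩ => ?_⟩ <;> linarith
  · intro h₁ h₂
    apply dsym_SISO_eq_of_isGreatest
    rw [max_eq_left (by linarith : 1 ≤ α), max_eq_right (by linarith : 1 - α ≤ 0),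
      max_eq_left (by linarith : 0 ≤ α)]
    refine ⟨⟨?_, ?_, ?_, ?_, ?_⟩, fun d ⟨_, _, _, _, _⟩ => ?_⟩ <;> linarith
  · intro h
    apply dsym_SISO_eq_of_isGreatest
    rw [max_eq_left (by linarith : 1 ≤ α), max_eq_right (by linarith : 1 - α ≤ 0),
      max_eq_left (by linarith : 0 ≤ α)]
    refine ⟨⟨?_, ?_, ?_, ?_, ?_⟩, fun d ⟨_, _, _, _, _⟩ => ?_⟩ <;> linarith
end

section
/- Threshold for single-user performance: let N ≤ M < 2N be positive integers and α > 0 a real. For the (M,N,M,N) interference channel with exponents (1,α,α,1), the symmetric GDoF equals the single-user value, i.e. d_sym((M,N,M,N),(1,α,α,1)) = N, if and only if α ≥ 3 − M/N. -/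
/-- A receiver with at most as many antennas as either transmitter collects the stronger exponent
on all of its antennas. -/
lemma fFun_of_le {u v a b : ℝ} (hu : 0 ≤ u) (huv : u ≤ v) :
    fFun u (a, v) (b, v) = u * max a b := by
  have hv : min 0 v = 0 := min_eq_left (hu.trans huv)
  unfold fFun
  split_ifs with hab <;> simp only at hab
  · simp [huv, hv, max_eq_left hab]
  · simp [huv, hv, max_eq_right (not_le.mp hab).le]

/-- When the stronger pair is listed second and fits inside `u`, the first pair fills the rest. -/
lemma fFun_of_lt {u k b c : ℝ} (hk : 0 ≤ k) (hku : k ≤ u) (hbc : b < c) :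
    fFun u (b, u) (c, k) = k * c + (u - k) * b := by
  have h : max (u - k) 0 = u - k := max_eq_left (by linarith)
  have h' : min (u - k) u = u - k := min_eq_left (by linarith)
  simp [fFun, not_le.mpr hbc, h, h', min_eq_right hku]

/-- The two-pair function when the stronger pair is listed first and fits inside `u`, and the
second pair fills the rest. -/
lemma fFun_of_ge {u v a b : ℝ} (hvu : v ≤ u) (huv : u - v ≤ v) (hba : b ≤ a) :
    fFun u (a, v) (b, v) = v * a + (u - v) * b := by
  have h : max (u - v) 0 = u - v := max_eq_left (by linarith)
  simp [fFun, hba, h, min_eq_left huv, min_eq_right hvu]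

/-- If the first pair is dominant and saturates `u`, the other two pairs contribute nothing. -/
lemma gFun_of_le {u v w k a b c : ℝ} (huv : u ≤ v) (hw : 0 ≤ w) (hk : 0 ≤ k)
    (hbc : b < c) (hca : c ≤ a) :
    gFun u (a, v) (b, w) (c, k) = u * a := by
  have h : max (u - v - k) 0 = 0 := max_eq_right (by linarith)
  simp [gFun, gAux, hbc.le.trans hca, not_le.mpr hbc, hca, h, huv, hw, hk]

/-- threshold for single-user performance on the `(M,N,M,N)` channel
with `N ≤ M < 2N`. -/
theorem dsym_single_user_threshold (M N : ℕ) (hN : 0 < N) (hNM : N ≤ M) (hM2N : M < 2 * N)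
    (α : ℝ) (hα : 0 < α) :
    dsym M N M N α α 1 = (N : ℝ) ↔ 3 - (M : ℝ) / (N : ℝ) ≤ α := by
  have hN' : (0 : ℝ) < N := by exact_mod_cast hN
  have hNM' : (N : ℝ) ≤ M := by exact_mod_cast hNM
  have hM2N' : (M : ℝ) < 2 * N := by exact_mod_cast hM2N
  have hk : (0 : ℝ) ≤ M - N := by linarith
  have hmax : max ((M : ℝ) - N) 0 = M - N := max_eq_left hk
  have hmin : min (M : ℝ) N = N := min_eq_right hNM'
  have hβ : max (1 - α) 0 < 1 := max_lt (by linarith) one_pos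
  have hcross := fFun_of_le (a := α) (b := 1) hN'.le hNM'
  have hpriv := fFun_of_lt hk (by linarith : (M : ℝ) - N ≤ N) hβ
  have hthr : 3 - (M : ℝ) / N ≤ α ↔ 3 * (N : ℝ) - M ≤ α * N := by
    rw [← mul_le_mul_iff_left₀ hN', sub_mul, div_mul_cancel₀ _ hN'.ne']
  rw [hthr]
  constructor
  · intro hsup
    have hB : (N : ℝ) ≤ (N * max α 1 + ((M - N) * 1 + (N - (M - N)) * max (1 - α) 0)) / 2 := by
      refine hsup.ge.trans (Real.sSup_le ?_ ?_)
      · rintro d ⟨-, -, -, -, -, h, -⟩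
        simp only [hmax, hmin, hcross, hpriv] at h
        linarith
      · have h₁ : 0 ≤ (N : ℝ) * max α 1 := by positivity
        have h₂ : 0 ≤ ((N : ℝ) - (M - N)) * max (1 - α) 0 :=
          mul_nonneg (by linarith) (le_max_right _ _)
        linarith
    rcases le_or_gt 1 α with h | h
    · rw [max_eq_left h, max_eq_right (by linarith : 1 - α ≤ 0)] at hB
      linarith
    · rw [max_eq_right h.le, max_eq_left (by linarith : 0 ≤ 1 - α)] at hB
      nlinarith [mul_pos hα (by linarith : (0 : ℝ) < 2 * N - M)]
  · intro h
    have h1 : 1 ≤ α := by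
      by_contra! hlt
      nlinarith
    have hNα : (N : ℝ) ≤ α * N := le_mul_of_one_le_left hN'.le h1
    have hβ0 : max (1 - α) 0 = 0 := max_eq_right (by linarith)
    rw [max_eq_left h1] at hcross
    rw [hβ0] at hpriv
    have hg := gFun_of_le (u := N) (v := M) (w := N) hNM' hN'.le hk zero_lt_one h1
    have hf := fFun_of_ge (u := M) (v := N) hNM' (by linarith) h1
    refine IsGreatest.csSup_eq ⟨⟨hN'.le, hN'.le, hN'.le, ?_⟩, ?_⟩
    · simp only [hmax, hmin, hβ0, hcross, hpriv, hg, hf]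
      refine ⟨le_rfl, le_rfl, ?_, ?_, ?_, ?_, ?_⟩ <;> linarith
    · rintro d ⟨-, -, -, hd, -⟩
      simpa only [hmin] using hd
end

section
/- Single-user performance for M ≥ 2N: let M ≥ 2N ≥ 2 be positive integers. For every real α ≥ 0, the symmetric GDoF of the (M,N,M,N) interference channel with exponents (1,α,α,1) equals the single-user value: d_sym((M,N,M,N),(1,α,α,1)) = N. -/
/-- If all sizes are at least `u` and one coefficient is `1`, then `f` is at least `u`. -/
theorem le_fFun_one {u v a b c : ℝ} (hu : 0 ≤ u) (huv : u ≤ v) (ha : 0 ≤ a)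
    (hb : u ≤ b) (hc : u ≤ c) : u ≤ fFun v (a, b) (1, c) := by
  have hvb : u ≤ min v b := le_min huv hb
  have hvc : u ≤ min v c := le_min huv hc
  have h1 : 0 ≤ min (max (v - b) 0) c := le_min (le_max_right _ _) (hu.trans hc)
  have h2 : 0 ≤ min (max (v - c) 0) b := le_min (le_max_right _ _) (hu.trans hb)
  unfold fFun
  dsimp only
  split_ifs with h
  · nlinarith
  · nlinarith [mul_nonneg h2 ha]

/-- The ordered expression is at least `u` as soon as the leading pair has coefficient
at least `1` and size at least `u`. -/
theorem le_gAux {u : ℝ} {p q r : ℝ × ℝ} (hu : 0 ≤ u) (hp : 1 ≤ p.1) (hup : u ≤ p.2)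
    (hq : 0 ≤ q.1) (hq' : 0 ≤ q.2) (hr : 0 ≤ r.1) (hr' : 0 ≤ r.2) : u ≤ gAux u p q r := by
  have h1 : 0 ≤ min (max (u - p.2) 0) q.2 * q.1 :=
    mul_nonneg (le_min (le_max_right _ _) hq') hq
  have h2 : 0 ≤ min (max (u - p.2 - q.2) 0) r.2 * r.1 :=
    mul_nonneg (le_min (le_max_right _ _) hr') hr
  unfold gAux
  rw [min_eq_left hup]
  nlinarith

/-- If all sizes are at least `u` and one coefficient is `1`, then `g` is at least `u`. -/
theorem le_gFun_one {u a b c d e : ℝ} (hu : 0 ≤ u) (ha : 0 ≤ a) (hb : u ≤ b)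
    (hc : 0 ≤ c) (hd : u ≤ d) (he : u ≤ e) : u ≤ gFun u (a, b) (c, d) (1, e) := by
  unfold gFun
  dsimp only
  split_ifs <;> exact le_gAux hu (by linarith) (by linarith) (by linarith) (by linarith)
    (by linarith) (by linarith)

/-- single-user performance for `M ≥ 2N`. -/
theorem dsym_single_user_Mge2N (M N : ℕ) (hN : 0 < N) (hM : 2 * N ≤ M)
    (α : ℝ) (hα : 0 ≤ α) :
    dsym M N M N α α 1 = (N : ℝ) := by
  have hM' : 2 * (N : ℝ) ≤ M := by exact_mod_cast hM
  have hN' : (0 : ℝ) ≤ N := N.cast_nonneg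
  have hNM : (N : ℝ) ≤ M := by linarith
  have hsub : (N : ℝ) ≤ max ((M : ℝ) - N) 0 := le_max_of_le_left (by linarith)
  have hmin : (N : ℝ) ≤ min (M : ℝ) N := le_min hNM le_rfl
  have hβ : 0 ≤ max (1 - α) 0 := le_max_right _ _
  refine IsGreatest.csSup_eq ⟨⟨hN', ?_⟩, fun d hd => hd.2.2.2.1.trans (min_le_right _ _)⟩
  have h1 := le_fFun_one hN' le_rfl hα hNM hNM
  have h2 := le_fFun_one hN' le_rfl hβ hmin hsub
  have h3 := le_gFun_one hN' hα hNM hβ hmin hsub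
  have h4 := le_fFun_one hN' hNM hα le_rfl le_rfl
  refine ⟨hN', hN', hmin, hmin, ?_, ?_, ?_, ?_, ?_⟩ <;> dsimp only <;> linarith
end
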